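/- Let k be a field of characteristic 0, let a, b ∈ k with a ≠ 0, and set a' = −3a and b' = (4a+27b)/9. Let s ∈ k (or s transcendental over k) with s ≠ 0, and set S = (9/2)(b²s/9 + 9b'²/s). Assume S − 9bb' ≠ 0 and bs − 9b' ≠ 0. Define X = −(3S³ + c₂S² + c₁S + c₀)/(16aa'(S − 9bb')) and Y = −s(bs + 9b')(9S⁴ + d₃S³ + d₂S² + d₁S + d₀)/(288a³(bs − 9b')³), where c₂ = 8aa' + 81bb', c₁ = (16/9)a²a'² − 144aa'bb' + 729b²b'², c₀ = bb'(80a²a'² − 1944aa'bb' + 2187b²b'²), d₃ = 36(aa' + 9bb'), d₂ = 2(16a²a'² − 162aa'bb' + 2187b²b'²), d₁ = −108bb'(8a²a'² + 135aa'bb' − 243b²b'²), d₀ = −3bb'(128a³a'³ − 6912a²a'²bb' + 26244aa'b²b'² − 19683b³b'³). Then Y² = X³ − (1/3)aa'(a+6b)(a'+6b')·X − (1/4)(a²b³(4a+27b)·s + a'²b'³(4a'+27b')/s) + (1/54)aa'(3(a+3b)²−a²)(3(a'+3b')²−a'²). (This point is the section P⁽¹⁾_φ of the Inose fibration F⁽¹⁾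 arising from the 3-isogeny φ : E₁ → E₂.) -/

import Mathlib

/-- The Weierstrass equation after eliminating `s`: here `p = b * b'`, `q = a * a'`, and the
factor `(S + 9 * p) / (S - 9 * p) ^ 3` carries the dependence of `Y ^ 2` on `s`. -/
lemma weierstrass_identity_in_S {k : Type*} [Field k] [CharZero k] (p q S : k)
    (hq : q ≠ 0) (hS : S - 9 * p ≠ 0) :
    -((S + 9 * p) * (9 * S ^ 4 + 36 * (q + 9 * p) * S ^ 3
        + 2 * (16 * q ^ 2 - 162 * q * p + 2187 * p ^ 2) * S ^ 2
        + -108 * p * (8 * q ^ 2 + 135 * q * p - 243 * p ^ 2) * S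
        + -3 * p * (128 * q ^ 3 - 6912 * q ^ 2 * p + 26244 * q * p ^ 2 - 19683 * p ^ 3)) ^ 2
        / (12288 * q ^ 3 * (S - 9 * p) ^ 3)) =
      (-((3 * S ^ 3 + (8 * q + 81 * p) * S ^ 2
        + (16 / 9 * q ^ 2 - 144 * q * p + 729 * p ^ 2) * S
        + p * (80 * q ^ 2 - 1944 * q * p + 2187 * p ^ 2)) / (16 * q * (S - 9 * p)))) ^ 3
      - 1 / 3 * (q * (q / 9 + 36 * p)) * (-((3 * S ^ 3 + (8 * q + 81 * p) * S ^ 2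
        + (16 / 9 * q ^ 2 - 144 * q * p + 729 * p ^ 2) * S
        + p * (80 * q ^ 2 - 1944 * q * p + 2187 * p ^ 2)) / (16 * q * (S - 9 * p))))
      + 3 / 2 * q * p * S
      + 1 / 54 * (q * (-4 / 27 * q ^ 2 + 144 * q * p + 729 * p ^ 2)) := by
  field_simp
  ring


/-- The section `P⁽¹⁾_φ` of the Inose fibration `F⁽¹⁾` arising from the 3-isogeny
`φ : E₁ → E₂` with `E₁ : y² = x³ + a(x-b)²`, `E₂ : y² = x³ + a'(x-b')²`, `a' = -3a`,
`b' = (4a+27b)/9`: the displayed `(X, Y)` satisfies the Weierstrass equation of `F⁽¹⁾`. -/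
theorem section_P1_of_three_isogeny {k : Type*} [Field k] [CharZero k]
    (a b a' b' : k) (ha : a ≠ 0)
    (ha' : a' = -3 * a) (hb' : b' = (4 * a + 27 * b) / 9)
    (s : k) (hs : s ≠ 0)
    (S : k) (hS : S = 9 / 2 * (b ^ 2 * s / 9 + 9 * b' ^ 2 / s))
    (hS9 : S - 9 * b * b' ≠ 0) (hbs : b * s - 9 * b' ≠ 0)
    (c₂ c₁ c₀ d₃ d₂ d₁ d₀ X Y : k)
    (hc₂ : c₂ = 8 * a * a' + 81 * b * b')
    (hc₁ : c₁ = 16 / 9 * a ^ 2 * a' ^ 2 - 144 * a * a' * b * b' + 729 * b ^ 2 * b' ^ 2)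
    (hc₀ : c₀ = b * b' * (80 * a ^ 2 * a' ^ 2 - 1944 * a * a' * b * b'
      + 2187 * b ^ 2 * b' ^ 2))
    (hd₃ : d₃ = 36 * (a * a' + 9 * b * b'))
    (hd₂ : d₂ = 2 * (16 * a ^ 2 * a' ^ 2 - 162 * a * a' * b * b' + 2187 * b ^ 2 * b' ^ 2))
    (hd₁ : d₁ = -108 * b * b' * (8 * a ^ 2 * a' ^ 2 + 135 * a * a' * b * b'
      - 243 * b ^ 2 * b' ^ 2))
    (hd₀ : d₀ = -3 * b * b' * (128 * a ^ 3 * a' ^ 3 - 6912 * a ^ 2 * a' ^ 2 * b * b'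
      + 26244 * a * a' * b ^ 2 * b' ^ 2 - 19683 * b ^ 3 * b' ^ 3))
    (hX : X = -((3 * S ^ 3 + c₂ * S ^ 2 + c₁ * S + c₀) / (16 * a * a' * (S - 9 * b * b'))))
    (hY : Y = -(s * (b * s + 9 * b') * (9 * S ^ 4 + d₃ * S ^ 3 + d₂ * S ^ 2 + d₁ * S + d₀) /
      (288 * a ^ 3 * (b * s - 9 * b') ^ 3))) :
    Y ^ 2 = X ^ 3 - 1 / 3 * (a * a' * (a + 6 * b) * (a' + 6 * b')) * X
      - 1 / 4 * (a ^ 2 * b ^ 3 * (4 * a + 27 * b) * s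
        + a' ^ 2 * b' ^ 3 * (4 * a' + 27 * b') / s)
      + 1 / 54 * (a * a' * (3 * (a + 3 * b) ^ 2 - a ^ 2) * (3 * (a' + 3 * b') ^ 2 - a' ^ 2)) := by
  have hq : a * a' ≠ 0 := by
    rw [ha']
    exact mul_ne_zero ha (mul_ne_zero (by norm_num) ha)
  have hS_mul : 2 * s * S = b ^ 2 * s ^ 2 + 81 * b' ^ 2 := by
    rw [hS]
    field_simp
    ring
  have hsub : (b * s - 9 * b') ^ 2 = 2 * s * (S - 9 * (b * b')) := by
    linear_combination -hS_mul
  have hadd : (b * s + 9 * b') ^ 2 = 2 * s * (S + 9 * (b * b')) := by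
    linear_combination -hS_mul
  have hS9' : S - 9 * (b * b') ≠ 0 := by rwa [← mul_assoc]
  have hlin : (a + 6 * b) * (a' + 6 * b') = a * a' / 9 + 36 * (b * b') := by
    rw [ha', hb']
    ring
  have hconst : (3 * (a + 3 * b) ^ 2 - a ^ 2) * (3 * (a' + 3 * b') ^ 2 - a' ^ 2) =
      -4 / 27 * (a * a') ^ 2 + 144 * (a * a') * (b * b') + 729 * (b * b') ^ 2 := by
    rw [ha', hb']
    ring
  have hpole : a ^ 2 * b ^ 3 * (4 * a + 27 * b) * s + a' ^ 2 * b' ^ 3 * (4 * a' + 27 * b') / s =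
      -6 * (a * a') * (b * b') * S := by
    have h₁ : 4 * a + 27 * b = 9 * b' := by
      rw [hb']
      ring
    have h₂ : 4 * a' + 27 * b' = 81 * b := by
      rw [ha', hb']
      ring
    rw [h₁, h₂, ha', hS]
    field_simp
    ring
  have hY_sq : ∀ D : k, (-(s * (b * s + 9 * b') * D / (288 * a ^ 3 * (b * s - 9 * b') ^ 3))) ^ 2 =
      -((S + 9 * (b * b')) * D ^ 2 / (12288 * (a * a') ^ 3 * (S - 9 * (b * b')) ^ 3)) := by
    intro D
    have h : (-(s * (b * s + 9 * b') * D / (288 * a ^ 3 * (b * s - 9 * b') ^ 3))) ^ 2 =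
        s ^ 2 * (b * s + 9 * b') ^ 2 * D ^ 2 /
          (82944 * a ^ 6 * ((b * s - 9 * b') ^ 2) ^ 3) := by
      field_simp
      ring
    rw [h, hadd, hsub, ha']
    field_simp
    ring
  have key := weierstrass_identity_in_S (b * b') (a * a') S hq hS9'
  rw [hY, hY_sq, mul_assoc (a * a') (a + 6 * b), hlin, hpole, mul_assoc (a * a') (_ - _), hconst,
    hX, hc₂, hc₁, hc₀, hd₃, hd₂, hd₁, hd₀]
  ring_nf at key ⊢
  exact key
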